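/- The sequence 0 → I[R] → ℤ[Λ] → ℤ[X] ⊕ ℤ → ℤ → 0 is exact, where the first map is the restriction of ν_{Λ/R} to I[R], the second map sends α ∈ ℤ[Λ] to (σ(α), ε_Λ(α)), and the third map sends (ξ, n) ∈ ℤ[X] ⊕ ℤ to ε_X(ξ) − 2n. -/

import Mathlib

open Finsupp LinearMap Function

/-- The set of 2-element subsets of a finite set `X`. -/
abbrev Pairs (X : Type) : Type := {s : Finset X // s.card = 2}

/-- The complement map `γ : Λ → Λ` sending a 2-element subset of a 4-element set to its
complement. -/
def gammaMap (X : Type) [Fintype X] [DecidableEq X] (hX : Fintype.card X = 4) :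
    Pairs X → Pairs X :=
  fun l => ⟨(l : Finset X)ᶜ, by rw [Finset.card_compl, l.2, hX]⟩

/-- The augmentation `ε_E : ℤ[E] → ℤ`. -/
noncomputable def epsAug (E : Type) : (E →₀ ℤ) →ₗ[ℤ] ℤ :=
  Finsupp.lsum ℤ fun _ => LinearMap.id

/-- The norm `ν_E : ℤ → ℤ[E]`, `1 ↦ Σ_{e ∈ E} e`. -/
noncomputable def nuNorm (E : Type) [Fintype E] : ℤ →ₗ[ℤ] (E →₀ ℤ) :=
  ∑ e : E, Finsupp.lsingle e

/-- The relative augmentation `ε_{Λ/R} : ℤ[Λ] → ℤ[R]`, `λ ↦ π(λ)`. -/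
noncomputable def epsRel {Λ R : Type} (π : Λ → R) : (Λ →₀ ℤ) →ₗ[ℤ] (R →₀ ℤ) :=
  Finsupp.lmapDomain ℤ ℤ π

/-- The relative norm `ν_{Λ/R} : ℤ[R] → ℤ[Λ]`, `r ↦ Σ_{π(λ) = r} λ`. -/
noncomputable def nuRel {Λ R : Type} [Fintype Λ] [DecidableEq R] (π : Λ → R) :
    (R →₀ ℤ) →ₗ[ℤ] (Λ →₀ ℤ) :=
  Finsupp.lsum ℤ fun r => ∑ l ∈ Finset.univ.filter fun l => π l = r, Finsupp.lsingle l

/-- The map `σ : ℤ[Λ] → ℤ[X]`, `λ ↦ Σ_{x ∈ λ} x`. -/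
noncomputable def sigmaMap (X : Type) [Fintype X] [DecidableEq X] :
    (Pairs X →₀ ℤ) →ₗ[ℤ] (X →₀ ℤ) :=
  Finsupp.lsum ℤ fun l => ∑ x ∈ (l : Finset X), Finsupp.lsingle x

/-- The map `τ : ℤ[X] → ℤ[Λ]`, `x ↦ Σ_{λ ∋ x} λ`. -/
noncomputable def tauMap (X : Type) [Fintype X] [DecidableEq X] :
    (X →₀ ℤ) →ₗ[ℤ] (Pairs X →₀ ℤ) :=
  Finsupp.lsum ℤ fun x =>
    ∑ l ∈ Finset.univ.filter fun l : Pairs X => x ∈ (l : Finset X), Finsupp.lsingle l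

set_option linter.unusedSimpArgs false

theorem epsAug_apply {E : Type} [Fintype E] (f : E →₀ ℤ) : epsAug E f = ∑ e, f e := by
  simp [epsAug, Finsupp.sum_fintype]

theorem nuRel_apply {Λ R : Type} [Fintype Λ] [DecidableEq R] (π : Λ → R) (f : R →₀ ℤ) (l : Λ) :
    nuRel π f l = f (π l) := by
  classical
  induction f using Finsupp.induction_linear with
  | zero => simp
  | add f g hf hg => simp [hf, hg]
  | single r n =>
    simp [nuRel, Finsupp.finsetSum_apply, Finsupp.single_apply, Finset.sum_ite_eq', eq_comm]

theorem sigmaMap_apply {X : Type} [Fintype X] [DecidableEq X] (f : Pairs X →₀ ℤ) (x : X) :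
    sigmaMap X f x = ∑ l : Pairs X, if x ∈ (l : Finset X) then f l else 0 := by
  classical
  simp [sigmaMap, Finsupp.sum_fintype, Finsupp.finsetSum_apply, Finsupp.single_apply]

theorem exists_four (X : Type) [Fintype X] [DecidableEq X] (hX : Fintype.card X = 4) :
    ∃ a b c d : X, a ≠ b ∧ a ≠ c ∧ a ≠ d ∧ b ≠ c ∧ b ≠ d ∧ c ≠ d ∧
      (Finset.univ : Finset X) = {a, b, c, d} := by
  have e := (Fintype.equivFinOfCardEq hX).symm
  refine ⟨e 0, e 1, e 2, e 3, by simp, by simp, by simp, by simp, by simp, by simp, ?_⟩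
  ext x
  obtain ⟨i, rfl⟩ := e.surjective x
  fin_cases i <;> simp

/-- The pair `{a, b}`. -/
def mkPair {X : Type} [DecidableEq X] (a b : X) (h : a ≠ b) : Pairs X :=
  ⟨{a, b}, Finset.card_pair h⟩

theorem univ_pairs {X : Type} [Fintype X] [DecidableEq X] {a b c d : X}
    (hab : a ≠ b) (hac : a ≠ c) (had : a ≠ d) (hbc : b ≠ c) (hbd : b ≠ d) (hcd : c ≠ d)
    (hu : (Finset.univ : Finset X) = {a, b, c, d}) :
    (Finset.univ : Finset (Pairs X)) = {mkPair a b hab, mkPair a c hac, mkPair a d had,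
      mkPair b c hbc, mkPair b d hbd, mkPair c d hcd} := by
  ext ⟨s, hs⟩
  obtain ⟨x, y, hxy, rfl⟩ := Finset.card_eq_two.1 hs
  have hx : x ∈ (Finset.univ : Finset X) := Finset.mem_univ x
  have hy : y ∈ (Finset.univ : Finset X) := Finset.mem_univ y
  rw [hu] at hx hy
  simp only [Finset.mem_insert, Finset.mem_singleton] at hx hy
  simp only [Finset.mem_univ, true_iff, Finset.mem_insert, Finset.mem_singleton, mkPair,
    Subtype.mk.injEq]
  rcases hx with rfl | rfl | rfl | rfl <;> rcases hy with rfl | rfl | rfl | rfl <;>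
    simp_all [Finset.pair_comm]

theorem mkPair_eq_iff {X : Type} [DecidableEq X] {a b c d : X} (hab : a ≠ b) (hcd : c ≠ d) :
    mkPair a b hab = mkPair c d hcd ↔ (a = c ∧ b = d) ∨ (a = d ∧ b = c) := by
  simp only [mkPair, Subtype.mk.injEq]
  rw [← Finset.coe_inj]
  push_cast
  exact Set.pair_eq_pair_iff

theorem sum_pairs {X : Type} [Fintype X] [DecidableEq X] {a b c d : X}
    (hab : a ≠ b) (hac : a ≠ c) (had : a ≠ d) (hbc : b ≠ c) (hbd : b ≠ d) (hcd : c ≠ d)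
    (hu : (Finset.univ : Finset X) = {a, b, c, d}) (f : Pairs X → ℤ) :
    ∑ l, f l = f (mkPair a b hab) + f (mkPair a c hac) + f (mkPair a d had) +
      f (mkPair b c hbc) + f (mkPair b d hbd) + f (mkPair c d hcd) := by
  rw [univ_pairs hab hac had hbc hbd hcd hu]
  repeat rw [Finset.sum_insert (by
    simp [mkPair_eq_iff, hab, hac, had, hbc, hbd, hcd, hab.symm, hac.symm, had.symm, hbc.symm,
      hbd.symm, hcd.symm])]
  rw [Finset.sum_singleton]
  ring

/-- The sequence `0 → I[R] → ℤ[Λ] → ℤ[X] ⊕ ℤ → ℤ → 0` is exact, where the first map is the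
restriction of `ν_{Λ/R}` to `I[R]`, the second map is `α ↦ (σ(α), ε_Λ(α))`, and the third map
is `(ξ, n) ↦ ε_X(ξ) − 2n`. -/
theorem statement4 (X R : Type) [Fintype X] [DecidableEq X] [DecidableEq R]
    (hX : Fintype.card X = 4) (π : Pairs X → R)
    (hπsurj : Surjective π)
    (hπ : ∀ l m : Pairs X, π l = π m ↔ m = l ∨ m = gammaMap X hX l) :
    Injective ((nuRel π) ∘ₗ (LinearMap.ker (epsAug R)).subtype) ∧
      LinearMap.range ((nuRel π) ∘ₗ (LinearMap.ker (epsAug R)).subtype) =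
        LinearMap.ker ((sigmaMap X).prod (epsAug (Pairs X))) ∧
      LinearMap.range ((sigmaMap X).prod (epsAug (Pairs X))) =
        LinearMap.ker ((epsAug X) ∘ₗ LinearMap.fst ℤ (X →₀ ℤ) ℤ -
          (2 : ℤ) • LinearMap.snd ℤ (X →₀ ℤ) ℤ) ∧
      Surjective ((epsAug X) ∘ₗ LinearMap.fst ℤ (X →₀ ℤ) ℤ -
          (2 : ℤ) • LinearMap.snd ℤ (X →₀ ℤ) ℤ) := by
  classical
  obtain ⟨a, b, c, d, hab, hac, had, hbc, hbd, hcd, hu⟩ := exists_four X hX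
  have hS := sum_pairs hab hac had hbc hbd hcd hu
  have hU : ∀ l : Pairs X, _ := fun l =>
    (univ_pairs hab hac had hbc hbd hcd hu) ▸ Finset.mem_univ l
  simp only [Finset.mem_insert, Finset.mem_singleton] at hU
  have hX4 : ∀ f : X → ℤ, ∑ x, f x = f a + f b + f c + f d := by
    intro f
    rw [hu]
    simp [hab, hac, had, hbc, hbd, hcd, add_assoc]
  have hxx : ∀ x : X, x = a ∨ x = b ∨ x = c ∨ x = d := by
    intro x
    have hx := Finset.mem_univ x
    rw [hu] at hx
    simpa using hx
  -- complements
  have hg : ∀ (x y z w : X) (h : x ≠ y) (h' : z ≠ w), x ≠ z → x ≠ w → y ≠ z → y ≠ w →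
      gammaMap X hX (mkPair x y h) = mkPair z w h' := by
    intro x y z w h h' h1 h2 h3 h4
    symm
    apply Subtype.ext
    apply Finset.eq_of_subset_of_card_le
    · intro t ht
      simp only [gammaMap, mkPair, Finset.mem_insert, Finset.mem_singleton,
        Finset.mem_compl] at ht ⊢
      rcases ht with rfl | rfl <;> simp [h1.symm, h2.symm, h3.symm, h4.symm]
    · rw [(gammaMap X hX (mkPair x y h)).2, (mkPair z w h').2]
  have g1 := hg a b c d hab hcd hac had hbc hbd
  have g2 := hg a c b d hac hbd hab had hbc.symm hcd
  have g3 := hg a d b c had hbc hab hac hbd.symm hcd.symm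
  have e1 : π (mkPair c d hcd) = π (mkPair a b hab) := ((hπ _ _).2 (Or.inr g1.symm)).symm
  have e2 : π (mkPair b d hbd) = π (mkPair a c hac) := ((hπ _ _).2 (Or.inr g2.symm)).symm
  have e3 : π (mkPair b c hbc) = π (mkPair a d had) := ((hπ _ _).2 (Or.inr g3.symm)).symm
  have n1 : π (mkPair a b hab) ≠ π (mkPair a c hac) := by
    rw [Ne, hπ, g1]
    simp [mkPair_eq_iff, hbc, hbc.symm, hac, had, hab]
  have n2 : π (mkPair a b hab) ≠ π (mkPair a d had) := by
    rw [Ne, hπ, g1]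
    simp [mkPair_eq_iff, hbd, hbd.symm, hac, had, hab]
  have n3 : π (mkPair a c hac) ≠ π (mkPair a d had) := by
    rw [Ne, hπ, g2]
    simp [mkPair_eq_iff, hcd, hcd.symm, hac, had, hab]
  let _ : Fintype R := Fintype.ofSurjective π hπsurj
  have hRu : (Finset.univ : Finset R) =
      {π (mkPair a b hab), π (mkPair a c hac), π (mkPair a d had)} := by
    ext r
    obtain ⟨l, rfl⟩ := hπsurj r
    rcases hU l with h | h | h | h | h | h <;> simp [h, e1, e2, e3]
  have hR : ∀ f : R → ℤ, ∑ r, f r =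
      f (π (mkPair a b hab)) + f (π (mkPair a c hac)) + f (π (mkPair a d had)) := by
    intro f
    rw [hRu]
    simp [n1, n2, n3, add_assoc]
  have s1 : ∀ α, sigmaMap X α a = α (mkPair a b hab) + α (mkPair a c hac) + α (mkPair a d had) := by
    intro α
    rw [sigmaMap_apply, hS]
    simp [mkPair, hab, hac, had]
  have s2 : ∀ α, sigmaMap X α b = α (mkPair a b hab) + α (mkPair b c hbc) + α (mkPair b d hbd) := by
    intro α
    rw [sigmaMap_apply, hS]
    simp [mkPair, hab.symm, hbc, hbd]
  have s3 : ∀ α, sigmaMap X α c = α (mkPair a c hac) + α (mkPair b c hbc) + α (mkPair c d hcd) := by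
    intro α
    rw [sigmaMap_apply, hS]
    simp [mkPair, hac.symm, hbc.symm, hcd]
  have s4 : ∀ α, sigmaMap X α d = α (mkPair a d had) + α (mkPair b d hbd) + α (mkPair c d hcd) := by
    intro α
    rw [sigmaMap_apply, hS]
    simp [mkPair, had.symm, hbd.symm, hcd.symm]
  refine ⟨?_, ?_, ?_, ?_⟩
  · intro f g hfg
    apply Subtype.ext
    ext r
    obtain ⟨l, rfl⟩ := hπsurj r
    have := DFunLike.congr_fun hfg l
    simpa [nuRel_apply] using this
  · ext α
    simp only [LinearMap.mem_range, LinearMap.mem_ker, LinearMap.prod_apply, Function.prod,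
      Prod.mk_eq_zero, LinearMap.comp_apply, Submodule.subtype_apply]
    constructor
    · rintro ⟨⟨f, hf⟩, rfl⟩
      rw [LinearMap.mem_ker, epsAug_apply, hR] at hf
      constructor
      · ext x
        rcases hxx x with rfl | rfl | rfl | rfl
        · rw [s1]; simp only [nuRel_apply, e1, e2, e3, Finsupp.zero_apply]; linarith
        · rw [s2]; simp only [nuRel_apply, e1, e2, e3, Finsupp.zero_apply]; linarith
        · rw [s3]; simp only [nuRel_apply, e1, e2, e3, Finsupp.zero_apply]; linarith
        · rw [s4]; simp only [nuRel_apply, e1, e2, e3, Finsupp.zero_apply]; linarith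
      · rw [epsAug_apply, hS]
        simp only [nuRel_apply, e1, e2, e3]
        linarith
    · rintro ⟨hs, -⟩
      have t1 := s1 α
      have t2 := s2 α
      have t3 := s3 α
      have t4 := s4 α
      rw [hs, Finsupp.zero_apply] at t1 t2 t3 t4
      let f : R →₀ ℤ := Finsupp.single (π (mkPair a b hab)) (α (mkPair a b hab)) +
        Finsupp.single (π (mkPair a c hac)) (α (mkPair a c hac)) +
        Finsupp.single (π (mkPair a d had)) (α (mkPair a d had))
      have f1 : f (π (mkPair a b hab)) = α (mkPair a b hab) := by
        simp [f, Finsupp.single_apply, n1, n2, n3, n1.symm, n2.symm, n3.symm]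
      have f2 : f (π (mkPair a c hac)) = α (mkPair a c hac) := by
        simp [f, Finsupp.single_apply, n1, n2, n3, n1.symm, n2.symm, n3.symm]
      have f3 : f (π (mkPair a d had)) = α (mkPair a d had) := by
        simp [f, Finsupp.single_apply, n1, n2, n3, n1.symm, n2.symm, n3.symm]
      refine ⟨⟨f, ?_⟩, ?_⟩
      · rw [LinearMap.mem_ker, epsAug_apply, hR, f1, f2, f3]
        exact t1.symm
      · ext l
        rw [nuRel_apply]
        rcases hU l with h | h | h | h | h | h <;> subst h <;>
          simp only [e1, e2, e3, f1, f2, f3] <;> linarith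
  · ext ⟨ξ, n⟩
    simp only [LinearMap.mem_range, LinearMap.mem_ker, LinearMap.prod_apply, Function.prod,
      Prod.mk.injEq, LinearMap.sub_apply, LinearMap.smul_apply, LinearMap.comp_apply,
      LinearMap.fst_apply, LinearMap.snd_apply, smul_eq_mul]
    constructor
    · rintro ⟨α, rfl, rfl⟩
      rw [epsAug_apply, epsAug_apply, hX4, hS, s1, s2, s3, s4]
      ring
    · intro h
      rw [epsAug_apply, hX4] at h
      let α : Pairs X →₀ ℤ := Finsupp.single (mkPair a b hab) (ξ b - n + ξ a) +
        Finsupp.single (mkPair a c hac) (ξ c - n + ξ a) +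
        Finsupp.single (mkPair a d had) (ξ d) +
        Finsupp.single (mkPair b c hbc) (n - ξ a)
      have a1 : α (mkPair a b hab) = ξ b - n + ξ a := by
        simp [α, Finsupp.single_apply, mkPair_eq_iff, hab, hac, had, hbc, hbd, hcd,
          hab.symm, hac.symm, had.symm, hbc.symm, hbd.symm, hcd.symm]
      have a2 : α (mkPair a c hac) = ξ c - n + ξ a := by
        simp [α, Finsupp.single_apply, mkPair_eq_iff, hab, hac, had, hbc, hbd, hcd,
          hab.symm, hac.symm, had.symm, hbc.symm, hbd.symm, hcd.symm]
      have a3 : α (mkPair a d had) = ξ d := by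
        simp [α, Finsupp.single_apply, mkPair_eq_iff, hab, hac, had, hbc, hbd, hcd,
          hab.symm, hac.symm, had.symm, hbc.symm, hbd.symm, hcd.symm]
      have a4 : α (mkPair b c hbc) = n - ξ a := by
        simp [α, Finsupp.single_apply, mkPair_eq_iff, hab, hac, had, hbc, hbd, hcd,
          hab.symm, hac.symm, had.symm, hbc.symm, hbd.symm, hcd.symm]
      have a5 : α (mkPair b d hbd) = 0 := by
        simp [α, Finsupp.single_apply, mkPair_eq_iff, hab, hac, had, hbc, hbd, hcd,
          hab.symm, hac.symm, had.symm, hbc.symm, hbd.symm, hcd.symm]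
      have a6 : α (mkPair c d hcd) = 0 := by
        simp [α, Finsupp.single_apply, mkPair_eq_iff, hab, hac, had, hbc, hbd, hcd,
          hab.symm, hac.symm, had.symm, hbc.symm, hbd.symm, hcd.symm]
      refine ⟨α, ?_, ?_⟩
      · ext x
        rcases hxx x with h | h | h | h <;> subst h
        · rw [s1, a1, a2, a3]; linarith
        · rw [s2, a1, a4, a5]; linarith
        · rw [s3, a2, a4, a6]; linarith
        · rw [s4, a3, a5, a6]; linarith
      · rw [epsAug_apply, hS, a1, a2, a3, a4, a5, a6]
        linarith
  · intro n
    refine ⟨(Finsupp.single a n, 0), ?_⟩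
    simp [epsAug]
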